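/- Let G be a group generated by a finite set A, let π : (A ∪ A⁻¹)* → G be the canonical surjective monoid homomorphism, and let K ⊆ G. Then K is a recognizable subset of G if and only if there exist a finite index subgroup H ≤ G and finitely many elements g₁, …, g_n ∈ G such that K = Hg₁ ∪ ⋯ ∪ Hg_n (i.e., K is a finite union of cosets of a subgroup of finite index). -/

import Mathlib

/-- The canonical monoid homomorphism `π` from the free monoid over the alphabet
`X ⊕ X` (generators and their formal inverses) to a group `G`, induced by `f : X → G`:
a left letter `Sum.inl x` is sent to `f x` and a right (formal inverse) letter
`Sum.inr x` is sent to `(f x)⁻¹`. -/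
def wordHom {X G : Type} [Group G] (f : X → G) : FreeMonoid (X ⊕ X) →* G :=
  FreeMonoid.lift (Sum.elim f fun x => (f x)⁻¹)

/-- A subset `K ⊆ G` is recognizable (with respect to the generating map `f : X → G`)
if its full preimage under the canonical homomorphism is a regular language
over the alphabet of generators and formal inverses. -/
def IsRecognizableSubset {X G : Type} [Group G] (f : X → G) (K : Set G) : Prop :=
  Language.IsRegular
    ({w : List (X ⊕ X) | wordHom f (FreeMonoid.ofList w) ∈ K} : Language (X ⊕ X))

theorem wordHom_surj_aux {X G : Type} [Group G] (f : X → G)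
    (hgen : Subgroup.closure (Set.range f) = ⊤) (g : G) :
    ∃ w : List (X ⊕ X), wordHom f (FreeMonoid.ofList w) = g := by
  have hg : g ∈ Subgroup.closure (Set.range f) := by rw [hgen]; trivial
  have key : g ∈ MonoidHom.mrange (wordHom f) := by
    rw [← Subgroup.mem_toSubmonoid, Subgroup.closure_toSubmonoid] at hg
    refine (Submonoid.closure_le.mpr ?_) hg
    rintro x (⟨a, rfl⟩ | ⟨a, ha⟩)
    · exact ⟨FreeMonoid.of (Sum.inl a), by simp [wordHom]⟩
    · exact ⟨FreeMonoid.of (Sum.inr a), by simp [wordHom, ha]⟩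
  obtain ⟨w, hw⟩ := key
  exact ⟨FreeMonoid.toList w, by simpa using hw⟩

/-- A subset `K` of a group `G` generated by a finite set is recognizable if and only
if `K` is a finite union of (right) cosets `H gᵢ` of a subgroup `H` of finite index. -/
theorem isRecognizableSubset_iff_union_cosets {X G : Type} [Fintype X] [Group G] (f : X → G)
    (hgen : Subgroup.closure (Set.range f) = ⊤)
    (K : Set G) :
    IsRecognizableSubset f K ↔
      ∃ (H : Subgroup G), H.FiniteIndex ∧ ∃ (n : ℕ) (g : Fin n → G),
        K = ⋃ i : Fin n, (fun h => h * g i) '' (H : Set G) := by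
  unfold IsRecognizableSubset
  refine Iff.trans Language.isRegular_iff_finite_range_leftQuotient ?_
  constructor
  · intro hfin
    let H : Subgroup G :=
      { carrier := {h | ∀ k, h * k ∈ K ↔ k ∈ K}
        one_mem' := by intro k; simp
        mul_mem' := by
          intro a b ha hb k
          rw [mul_assoc, ha, hb]
        inv_mem' := by
          intro a ha k
          rw [← ha (a⁻¹ * k), mul_inv_cancel_left] }
    have hH : ∀ h, h ∈ H ↔ ∀ k, h * k ∈ K ↔ k ∈ K := fun h => Iff.rfl
    choose s hs using wordHom_surj_aux f hgen
    have hq : Finite (G ⧸ H) := by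
      have := hfin.to_subtype
      refine Finite.of_injective (fun q : G ⧸ H =>
        (⟨_, ⟨s q.out⁻¹, rfl⟩⟩ : Set.range (Language.leftQuotient
          ({w : List (X ⊕ X) | wordHom f (FreeMonoid.ofList w) ∈ K} : Language (X ⊕ X))))) ?_
      intro p q hpq
      have h1 := congrArg Subtype.val hpq
      have h2 : ∀ k, p.out⁻¹ * k ∈ K ↔ q.out⁻¹ * k ∈ K := by
        intro k
        have h3 := Set.ext_iff.mp h1 (s k)
        change wordHom f (FreeMonoid.ofList (_ ++ _)) ∈ K ↔
          wordHom f (FreeMonoid.ofList (_ ++ _)) ∈ K at h3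
        simpa only [FreeMonoid.ofList_append, map_mul, hs] using h3
      rw [← p.out_eq', ← q.out_eq']
      refine QuotientGroup.eq.mpr ((hH _).mpr fun k => ?_)
      rw [mul_assoc, h2, inv_mul_cancel_left]
    refine ⟨H, Subgroup.finiteIndex_of_finite_quotient, ?_⟩
    obtain ⟨n, ⟨e⟩⟩ := Finite.exists_equiv_fin {q : G ⧸ H // q.out⁻¹ ∈ K}
    refine ⟨n, fun i => (e.symm i).1.out⁻¹, ?_⟩
    ext k
    simp only [Set.mem_iUnion, Set.mem_image, SetLike.mem_coe]
    constructor
    · intro hk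
      have hm : k * (QuotientGroup.mk k⁻¹ : G ⧸ H).out ∈ H := by
        have := QuotientGroup.eq.mp (QuotientGroup.out_eq' (QuotientGroup.mk k⁻¹ : G ⧸ H)).symm
        simpa using this
      have hK : (QuotientGroup.mk k⁻¹ : G ⧸ H).out⁻¹ ∈ K := by
        rw [← (hH _).mp hm]
        simpa using hk
      refine ⟨e ⟨_, hK⟩, _, hm, ?_⟩
      simp
    · rintro ⟨i, h, hh, rfl⟩
      exact ((hH _).mp hh _).mpr (e.symm i).2
  · rintro ⟨H, hfi, n, g, hK⟩
    have hinv : ∀ h ∈ H, ∀ k ∈ K, h * k ∈ K := by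
      intro h hh k hk
      rw [hK] at hk ⊢
      simp only [Set.mem_iUnion, Set.mem_image, SetLike.mem_coe] at hk ⊢
      obtain ⟨i, h', hh', rfl⟩ := hk
      exact ⟨i, h * h', H.mul_mem hh hh', mul_assoc _ _ _⟩
    have : Finite (G ⧸ H) := inferInstance
    refine (Set.finite_range (fun q : G ⧸ H =>
      ({w : List (X ⊕ X) | q.out⁻¹ * wordHom f (FreeMonoid.ofList w) ∈ K} :
        Language (X ⊕ X)))).subset ?_
    rintro _ ⟨w, rfl⟩
    refine ⟨QuotientGroup.mk (wordHom f (FreeMonoid.ofList w))⁻¹, ?_⟩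
    have hm := QuotientGroup.eq.mp (QuotientGroup.out_eq'
      (QuotientGroup.mk (wordHom f (FreeMonoid.ofList w))⁻¹ : G ⧸ H)).symm
    rw [inv_inv] at hm
    refine Set.ext fun y => ?_
    change _ * _ ∈ K ↔ wordHom f (FreeMonoid.ofList (w ++ y)) ∈ K
    rw [FreeMonoid.ofList_append, map_mul]
    constructor
    · intro h
      simpa [mul_assoc] using hinv _ hm _ h
    · intro h
      simpa [mul_assoc] using hinv _ (H.inv_mem hm) _ h
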